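/- Let (x,t) ∈ (0,∞)ⁿ × [0,T]. If for every convex f ∈ F and every direction v ∈ ℝⁿ \ {0} condition (cond) holds at (x,t), namely ∫₀¹ φ_vv(x,t,z)·( ∇f(x + φ(x,t,z)) − ∇f(x) ) dz ≥ 0, where φ_vv denotes the second directional x-derivative of φ in direction v, then the operator B is LCP at (x,t). -/

import Mathlib

open MeasureTheory Set Matrix NNReal

noncomputable section

/-- The open positive orthant `(0,∞)ⁿ` in `ℝⁿ`. -/
def posOrth (n : ℕ) : Set (Fin n → ℝ) := {x | ∀ i, 0 < x i}

/-- First directional derivative of `f` at `x` in direction `v`. -/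
def dir1 {n : ℕ} {F : Type*} [NormedAddCommGroup F] [NormedSpace ℝ F]
    (f : (Fin n → ℝ) → F) (x v : Fin n → ℝ) : F :=
  fderiv ℝ f x v

/-- Mixed second derivative: differentiate `f` in direction `v`, then in direction `w`. -/
def dmix {n : ℕ} {F : Type*} [NormedAddCommGroup F] [NormedSpace ℝ F]
    (f : (Fin n → ℝ) → F) (x v w : Fin n → ℝ) : F :=
  fderiv ℝ (fun y => fderiv ℝ f y v) x w

/-- Second directional derivative of `f` at `x` in direction `v`. -/
def dir2 {n : ℕ} {F : Type*} [NormedAddCommGroup F] [NormedSpace ℝ F]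
    (f : (Fin n → ℝ) → F) (x v : Fin n → ℝ) : F :=
  dmix f x v v

/-- The class `F` of test functions: `C⁴` on the positive orthant, with locally Hölder
continuous fourth derivatives, and with `f` together with its derivatives up to order two
of at most polynomial growth. -/
structure MemTestClass (n : ℕ) (f : (Fin n → ℝ) → ℝ) : Prop where
  smooth : ContDiffOn ℝ 4 f (posOrth n)
  holder4 : ∃ α : ℝ≥0, 0 < α ∧ (α : ℝ) ≤ 1 ∧
    ∀ x ∈ posOrth n, ∃ s ∈ nhds x, s ⊆ posOrth n ∧
      ∃ C : ℝ≥0, HolderOnWith C α (iteratedFDeriv ℝ 4 f) s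
  polyGrowth : ∃ C m : ℝ, ∀ x ∈ posOrth n, ∀ k : ℕ, k ≤ 2 →
    ‖iteratedFDeriv ℝ k f x‖ ≤ C * (1 + ‖x‖ ^ m)

/-- The jump structure `φ(x,t,z)` together with the standing assumptions (A3), (A6), (A7). -/
structure JumpKernel (n : ℕ) (T : ℝ) where
  φ : (Fin n → ℝ) → ℝ → ℝ → (Fin n → ℝ)
  meas : ∀ x ∈ posOrth n, ∀ t ∈ Icc (0:ℝ) T, Measurable (fun z => φ x t z)
  smooth : ∀ t ∈ Icc (0:ℝ) T, ∀ z ∈ Icc (0:ℝ) 1,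
    ContDiffOn ℝ 2 (fun x => φ x t z) (posOrth n)
  holder2 : ∃ α : ℝ≥0, 0 < α ∧ (α : ℝ) ≤ 1 ∧
    ∀ t ∈ Icc (0:ℝ) T, ∀ x ∈ posOrth n, ∃ s ∈ nhds x, s ⊆ posOrth n ∧
      ∃ C : ℝ≥0, ∀ z ∈ Icc (0:ℝ) 1,
        HolderOnWith C α (iteratedFDeriv ℝ 2 (fun y => φ y t z)) s
  bound : ∃ D : ℝ, 0 < D ∧ ∀ x ∈ posOrth n, ∀ t ∈ Icc (0:ℝ) T, ∀ z ∈ Icc (0:ℝ) 1,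
    ∀ i, (φ x t z i) ^ 2 ≤ D * (x i) ^ 2
  lower : ∃ γ₀ : ℝ, -1 < γ₀ ∧ ∀ x ∈ posOrth n, ∀ t ∈ Icc (0:ℝ) T, ∀ z ∈ Icc (0:ℝ) 1,
    ∀ i, γ₀ * x i < φ x t z i

/-- For each fixed `(x,t)`, `φ(x,t,z) ≠ 0` for almost every `z ∈ [0,1]`. -/
def JumpKernel.AENonzero {n : ℕ} {T : ℝ} (K : JumpKernel n T) : Prop :=
  ∀ x ∈ posOrth n, ∀ t ∈ Icc (0:ℝ) T,
    ∀ᵐ z ∂(volume.restrict (Icc (0:ℝ) 1)), K.φ x t z ≠ 0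

/-- The jump intensity `λ` : nonnegative and Hölder continuous on `[0,T]`. -/
def LamOK (T : ℝ) (lam : ℝ → ℝ) : Prop :=
  (∀ t ∈ Icc (0:ℝ) T, 0 ≤ lam t) ∧
  ∃ α C : ℝ≥0, 0 < α ∧ (α : ℝ) ≤ 1 ∧ HolderOnWith C α lam (Icc (0:ℝ) T)

/-- The integro-differential jump operator `B`. -/
def Bop {n : ℕ} {T : ℝ} (lam : ℝ → ℝ) (K : JumpKernel n T)
    (f : (Fin n → ℝ) → ℝ) (x : Fin n → ℝ) (t : ℝ) : ℝ :=
  lam t * ∫ z in Icc (0:ℝ) 1,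
    (f (x + K.φ x t z) - f x - fderiv ℝ f x (K.φ x t z))

/-- The diffusion matrix `β(x,t)` together with the standing assumptions (A1), (A3), (A5). -/
structure DiffKernel (n : ℕ) (T : ℝ) where
  β : (Fin n → ℝ) → ℝ → Matrix (Fin n) (Fin n) ℝ
  smooth : ∀ t ∈ Icc (0:ℝ) T, ∀ i j, ContDiffOn ℝ 2 (fun x => β x t i j) (posOrth n)
  holder2 : ∃ α : ℝ≥0, 0 < α ∧ (α : ℝ) ≤ 1 ∧
    ∀ t ∈ Icc (0:ℝ) T, ∀ i j, ∀ x ∈ posOrth n, ∃ s ∈ nhds x, s ⊆ posOrth n ∧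
      ∃ C : ℝ≥0, HolderOnWith C α (iteratedFDeriv ℝ 2 (fun y => β y t i j)) s
  nonsing : ∀ x ∈ posOrth n, ∀ t ∈ Icc (0:ℝ) T, (β x t).det ≠ 0
  bound : ∃ D : ℝ, 0 < D ∧ ∀ x ∈ posOrth n, ∀ t ∈ Icc (0:ℝ) T,
    ∀ i, ∑ j, (β x t i j) ^ 2 ≤ D * (x i) ^ 2

/-- The second order differential operator `A` with coefficient matrix `a = ββ*/2`. -/
def Aop {n : ℕ} {T : ℝ} (Dk : DiffKernel n T)
    (f : (Fin n → ℝ) → ℝ) (x : Fin n → ℝ) (t : ℝ) : ℝ :=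
  ∑ i, ∑ j, ((Dk.β x t * (Dk.β x t)ᵀ) i j / 2) *
    dmix f x (Pi.single i 1) (Pi.single j 1)

/-- An operator `D` (mapping a test function `f` to a function of `(x,t)`) is locally
convexity preserving (LCP) at `(x,t)` if `∂_v²(Df)(x,t) ≥ 0` for every direction `v ≠ 0`
and every convex `f ∈ F` with `∂_v²f(x) = 0`. -/
def IsLCPAt {n : ℕ} (D : ((Fin n → ℝ) → ℝ) → (Fin n → ℝ) → ℝ → ℝ)
    (x : Fin n → ℝ) (t : ℝ) : Prop :=
  ∀ v : Fin n → ℝ, v ≠ 0 → ∀ f : (Fin n → ℝ) → ℝ,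
    MemTestClass n f → ConvexOn ℝ (posOrth n) f → dir2 f x v = 0 →
    0 ≤ dir2 (fun y => D f y t) x v

/-- The integrand in condition (ohly) of Theorem 5.1. -/
def ohlyIntegrand {n : ℕ} {T : ℝ} (K : JumpKernel n T)
    (f : (Fin n → ℝ) → ℝ) (x v : Fin n → ℝ) (t z : ℝ) : ℝ :=
  dmix f (x + K.φ x t z) v v
    + 2 * dmix f (x + K.φ x t z) v (dir1 (fun y => K.φ y t z) x v)
    + dmix f (x + K.φ x t z) (dir1 (fun y => K.φ y t z) x v)
        (dir1 (fun y => K.φ y t z) x v)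
    + (fderiv ℝ f (x + K.φ x t z) (dir2 (fun y => K.φ y t z) x v)
        - fderiv ℝ f x (dir2 (fun y => K.φ y t z) x v))



section ParametricIntegral

variable {n : ℕ} {Z G : Type*} [MeasurableSpace Z] {μ : Measure Z}
  [NormedAddCommGroup G] [NormedSpace ℝ G]

/-- Directional derivatives of a parametrized family depend measurably on the parameter. -/
theorem aestronglyMeasurable_fderiv_apply_param {U : Set (Fin n → ℝ)} (hU : IsOpen U)
    {g : (Fin n → ℝ) → Z → G} (hmeas : ∀ y ∈ U, AEStronglyMeasurable (g y) μ)
    (hdiff : ∀ᵐ z ∂μ, DifferentiableOn ℝ (fun y => g y z) U)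
    {y : Fin n → ℝ} (hy : y ∈ U) (a : Fin n → ℝ) :
    AEStronglyMeasurable (fun z => fderiv ℝ (fun y => g y z) y a) μ := by
  classical
  have hev : ∀ᶠ c : ℝ in Filter.atTop, y + c⁻¹ • a ∈ U := by
    have h : Filter.Tendsto (fun c : ℝ => y + c⁻¹ • a) Filter.atTop (nhds (y + (0 : ℝ) • a)) :=
      tendsto_const_nhds.add (tendsto_inv_atTop_zero.smul_const a)
    rw [zero_smul, add_zero] at h
    exact h (hU.mem_nhds hy)
  refine aestronglyMeasurable_of_tendsto_ae (Filter.atTop : Filter ℝ)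
    (f := fun c z => if y + c⁻¹ • a ∈ U then c • (g (y + c⁻¹ • a) z - g y z) else 0) ?_ ?_
  · intro c
    by_cases h : y + c⁻¹ • a ∈ U
    · simp only [if_pos h]
      exact ((hmeas _ h).sub (hmeas y hy)).const_smul c
    · simpa only [if_neg h] using aestronglyMeasurable_const
  · filter_upwards [hdiff] with z hz
    refine (((hz y hy).differentiableAt (hU.mem_nhds hy)).hasFDerivAt.lim_real a).congr' ?_
    filter_upwards [hev] with c hc
    rw [if_pos hc]

/-- The derivative of a parametrized family depends measurably on the parameter. -/
theorem aestronglyMeasurable_fderiv_param {U : Set (Fin n → ℝ)} (hU : IsOpen U)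
    {g : (Fin n → ℝ) → Z → G} (hmeas : ∀ y ∈ U, AEStronglyMeasurable (g y) μ)
    (hdiff : ∀ᵐ z ∂μ, DifferentiableOn ℝ (fun y => g y z) U)
    {y : Fin n → ℝ} (hy : y ∈ U) :
    AEStronglyMeasurable (fun z => fderiv ℝ (fun y => g y z) y) μ := by
  have key : ∀ L : (Fin n → ℝ) →L[ℝ] G,
      L = ∑ i, ContinuousLinearMap.smulRightL ℝ (Fin n → ℝ) G
        (ContinuousLinearMap.proj i) (L (Pi.single i 1)) := by
    intro L
    ext a
    simp only [_root_.sum_apply, ContinuousLinearMap.smulRightL_apply_apply]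
    conv_lhs => rw [pi_eq_sum_univ' a]
    simp [map_sum]
  have h : (fun z => fderiv ℝ (fun y => g y z) y) = fun z =>
      ∑ i, ContinuousLinearMap.smulRightL ℝ (Fin n → ℝ) G (ContinuousLinearMap.proj i)
        (fderiv ℝ (fun y => g y z) y (Pi.single i 1)) := funext fun z => key _
  rw [h]
  refine Finset.aestronglyMeasurable_fun_sum _ fun i _ => ?_
  exact (ContinuousLinearMap.continuous _).comp_aestronglyMeasurable
    (aestronglyMeasurable_fderiv_apply_param hU hmeas hdiff hy _)

/-- Differentiation under the integral sign, in a fixed direction, for a family with uniformly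
bounded derivatives. -/
theorem fderiv_integral_apply_of_bounded [IsFiniteMeasure μ]
    {U : Set (Fin n → ℝ)} (hU : IsOpen U) {g : (Fin n → ℝ) → Z → ℝ} {C : ℝ}
    (hmeas : ∀ y ∈ U, AEStronglyMeasurable (g y) μ)
    (hdiff : ∀ᵐ z ∂μ, DifferentiableOn ℝ (fun y => g y z) U)
    (hbound : ∀ᵐ z ∂μ, ∀ y ∈ U, ‖g y z‖ ≤ C)
    (hbound' : ∀ᵐ z ∂μ, ∀ y ∈ U, ‖fderiv ℝ (fun y => g y z) y‖ ≤ C)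
    {y : Fin n → ℝ} (hy : y ∈ U) (a : Fin n → ℝ) :
    fderiv ℝ (fun y => ∫ z, g y z ∂μ) y a = ∫ z, fderiv ℝ (fun y => g y z) y a ∂μ := by
  have hm := aestronglyMeasurable_fderiv_param hU hmeas hdiff hy
  have h := hasFDerivAt_integral_of_dominated_of_fderiv_le (μ := μ) (𝕜 := ℝ) (F := g)
    (F' := fun y z => fderiv ℝ (fun y => g y z) y) (bound := fun _ => C)
    (hU.mem_nhds hy)
    (by filter_upwards [hU.mem_nhds hy] with w hw using hmeas w hw)
    (Integrable.of_bound (hmeas y hy) C (by filter_upwards [hbound] with z hz using hz y hy))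
    hm hbound' (integrable_const _)
    (by
      filter_upwards [hdiff] with z hz w hw
      exact ((hz w hw).differentiableAt (hU.mem_nhds hw)).hasFDerivAt)
  rw [h.fderiv]
  exact ContinuousLinearMap.integral_apply (Integrable.of_bound hm C
    (by filter_upwards [hbound'] with z hz using hz y hy)) a

/-- Second directional derivatives commute with the integral, for a family with uniformly bounded
first and second derivatives. -/
theorem dir2_integral_of_bounded [IsFiniteMeasure μ]
    {U : Set (Fin n → ℝ)} (hU : IsOpen U) {g : (Fin n → ℝ) → Z → ℝ} {C : ℝ}
    (hmeas : ∀ y ∈ U, AEStronglyMeasurable (g y) μ)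
    (hdiff : ∀ᵐ z ∂μ, ContDiffOn ℝ 2 (fun y => g y z) U)
    (hbound : ∀ᵐ z ∂μ, ∀ y ∈ U, ‖g y z‖ ≤ C)
    (hbound' : ∀ᵐ z ∂μ, ∀ y ∈ U, ‖fderiv ℝ (fun y => g y z) y‖ ≤ C)
    (hbound'' : ∀ᵐ z ∂μ, ∀ y ∈ U, ‖fderiv ℝ (fderiv ℝ (fun y => g y z)) y‖ ≤ C)
    {x : Fin n → ℝ} (hx : x ∈ U) (v : Fin n → ℝ) :
    dir2 (fun y => ∫ z, g y z ∂μ) x v = ∫ z, dir2 (fun y => g y z) x v ∂μ := by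
  have hdiff1 : ∀ᵐ z ∂μ, DifferentiableOn ℝ (fun y => g y z) U := by
    filter_upwards [hdiff] with z hz using hz.differentiableOn (by norm_num)
  have hdiff2 : ∀ᵐ z ∂μ, DifferentiableOn ℝ (fderiv ℝ (fun y => g y z)) U := by
    filter_upwards [hdiff] with z hz
    exact (hz.fderiv_of_isOpen (m := 1) hU (by norm_num)).differentiableOn (by norm_num)
  have hclm : ∀ᵐ z ∂μ, ∀ y ∈ U, HasFDerivAt (fun y => fderiv ℝ (fun y => g y z) y v)
      ((fderiv ℝ (fderiv ℝ (fun y => g y z)) y).flip v) y := by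
    filter_upwards [hdiff2] with z hz y hy
    have := ((hz y hy).differentiableAt (hU.mem_nhds hy)).hasFDerivAt.clm_apply
      (hasFDerivAt_const v y)
    simpa using this
  have hev : (fun y => fderiv ℝ (fun y => ∫ z, g y z ∂μ) y v) =ᶠ[nhds x]
      fun y => ∫ z, fderiv ℝ (fun y => g y z) y v ∂μ := by
    filter_upwards [hU.mem_nhds hx] with y hy
    exact fderiv_integral_apply_of_bounded hU hmeas hdiff1 hbound hbound' hy v
  unfold dir2 dmix
  rw [hev.fderiv_eq]
  refine fderiv_integral_apply_of_bounded (C := C * ‖v‖) hU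
    (g := fun y z => fderiv ℝ (fun y => g y z) y v)
    (fun y hy => aestronglyMeasurable_fderiv_apply_param hU hmeas hdiff1 hy v) ?_ ?_ ?_ hx v
  · filter_upwards [hclm] with z hz y hy
    exact (hz y hy).differentiableAt.differentiableWithinAt
  · filter_upwards [hbound'] with z hz y hy
    exact ContinuousLinearMap.le_of_opNorm_le _ (hz y hy) v
  · filter_upwards [hclm, hbound''] with z hz hz' y hy
    rw [(hz y hy).fderiv]
    refine (ContinuousLinearMap.le_opNorm _ v).trans ?_
    rw [ContinuousLinearMap.opNorm_flip]
    exact mul_le_mul_of_nonneg_right (hz' y hy) (norm_nonneg v)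

end ParametricIntegral

section DerivativeBounds

variable {E G : Type*} [NormedAddCommGroup E] [NormedSpace ℝ E]
  [NormedAddCommGroup G] [NormedSpace ℝ G]

theorem norm_fderiv_fderiv_sub_le (h : E → G) (x y : E) :
    ‖fderiv ℝ (fderiv ℝ h) x - fderiv ℝ (fderiv ℝ h) y‖
      ≤ ‖iteratedFDeriv ℝ 2 h x - iteratedFDeriv ℝ 2 h y‖ := by
  refine ContinuousLinearMap.opNorm_le_bound _ (norm_nonneg _) fun a => ?_
  refine ContinuousLinearMap.opNorm_le_bound _ (by positivity) fun b => ?_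
  have := (iteratedFDeriv ℝ 2 h x - iteratedFDeriv ℝ 2 h y).le_opNorm ![a, b]
  simpa [iteratedFDeriv_two_apply, Fin.prod_univ_two, mul_assoc] using this

/-- Interpolation: a function that is bounded and whose second derivative has bounded oscillation
on a ball has bounded first and second derivatives on that ball. -/
theorem exists_bound_fderiv_of_bound_of_osc {R : ℝ} (hR : 0 < R) (M K : ℝ) :
    ∃ B : ℝ, 0 ≤ B ∧ ∀ (h : E → G) (x : E), ContDiffOn ℝ 2 h (Metric.ball x R) →
      (∀ y ∈ Metric.ball x R, ‖h y‖ ≤ M) →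
      (∀ y ∈ Metric.ball x R, ‖iteratedFDeriv ℝ 2 h y - iteratedFDeriv ℝ 2 h x‖ ≤ K) →
      ∀ y ∈ Metric.ball x R, ‖fderiv ℝ h y‖ ≤ B ∧ ‖fderiv ℝ (fderiv ℝ h) y‖ ≤ B := by
  set r := R / 3 with hr
  have hr0 : 0 < r := by positivity
  set B₂ := (4 * M + K * r * r) / (r * r) + K with hB₂
  set B₁ := (2 * M + B₂ * r * r) / r + B₂ * R with hB₁
  refine ⟨max (max B₁ B₂) 0, le_max_right _ _, fun h x hh hM hK => ?_⟩
  have hxb : x ∈ Metric.ball x R := Metric.mem_ball_self hR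
  have hM0 : 0 ≤ M := (norm_nonneg _).trans (hM x hxb)
  have hK0 : 0 ≤ K := (norm_nonneg _).trans (hK x hxb)
  have hopen : IsOpen (Metric.ball x R) := Metric.isOpen_ball
  have hconv : Convex ℝ (Metric.ball x R) := convex_ball x R
  have hd1 : ∀ y ∈ Metric.ball x R, DifferentiableAt ℝ h y := fun y hy =>
    (hh.differentiableOn (by norm_num) y hy).differentiableAt (hopen.mem_nhds hy)
  have hd2 : ∀ y ∈ Metric.ball x R, DifferentiableAt ℝ (fderiv ℝ h) y := fun y hy =>
    ((hh.fderiv_of_isOpen (m := 1) hopen (by norm_num)).differentiableOn (by norm_num)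
      y hy).differentiableAt (hopen.mem_nhds hy)
  have hosc : ∀ y ∈ Metric.ball x R,
      ‖fderiv ℝ (fderiv ℝ h) y - fderiv ℝ (fderiv ℝ h) x‖ ≤ K := fun y hy =>
    (norm_fderiv_fderiv_sub_le h y x).trans (hK y hy)
  have hL : ‖fderiv ℝ (fderiv ℝ h) x‖ ≤ (4 * M + K * r * r) / (r * r) := by
    refine ContinuousLinearMap.opNorm_le_of_unit_norm (by positivity) fun b hb => ?_
    refine ContinuousLinearMap.opNorm_le_of_unit_norm (by positivity) fun a ha => ?_
    set L := fderiv ℝ (fderiv ℝ h) x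
    have hsub : Metric.ball x (2 * r) ⊆ Metric.ball x R :=
      Metric.ball_subset_ball (by rw [hr]; linarith)
    have hshift : ∀ y ∈ Metric.ball x (2 * r), y + r • b ∈ Metric.ball x R := by
      intro y hy
      rw [mem_ball_iff_norm] at hy ⊢
      calc ‖y + r • b - x‖ = ‖(y - x) + r • b‖ := by congr 1; abel
        _ ≤ ‖y - x‖ + ‖r • b‖ := norm_add_le _ _
        _ < 2 * r + r := by
          rw [norm_smul, hb, Real.norm_of_nonneg hr0.le]; linarith
        _ = R := by rw [hr]; ring
    have he : ∀ y ∈ Metric.ball x (2 * r), HasFDerivAt (fun y => h (y + r • b) - h y)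
        (fderiv ℝ h (y + r • b) - fderiv ℝ h y) y := fun y hy =>
      ((hasFDerivAt_comp_add_right _).2 (hd1 _ (hshift y hy)).hasFDerivAt).sub
        (hd1 y (hsub hy)).hasFDerivAt
    have hu : ∀ y ∈ Metric.ball x (2 * r),
        ‖fderiv ℝ h (y + r • b) - fderiv ℝ h y - L (r • b)‖ ≤ K * r := by
      intro y hy
      have := hconv.norm_image_sub_le_of_norm_fderiv_le' hd2 hosc (hsub hy) (hshift y hy)
      simpa [norm_smul, hb, abs_of_pos hr0] using this
    have hxa : x + r • a ∈ Metric.ball x (2 * r) := by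
      simp [norm_smul, ha, abs_of_pos hr0]; linarith
    have hxx : x ∈ Metric.ball x (2 * r) := Metric.mem_ball_self (by positivity)
    have hmv := (convex_ball x (2 * r)).norm_image_sub_le_of_norm_hasFDerivWithin_le'
      (fun y hy => (he y hy).hasFDerivWithinAt) hu hxx hxa
    have hnorm : ‖x + r • a - x‖ = r := by simp [norm_smul, ha, abs_of_pos hr0]
    rw [hnorm, add_sub_cancel_left] at hmv
    have h4 : ‖(h (x + r • a + r • b) - h (x + r • a)) - (h (x + r • b) - h x)‖ ≤ 4 * M := by
      have h1 := hM _ (hshift _ hxa)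
      have h2 := hM _ (hsub hxa)
      have h3 := hM _ (hshift _ hxx)
      have h4 := hM _ hxb
      have h5 := norm_sub_le (h (x + r • a + r • b) - h (x + r • a)) (h (x + r • b) - h x)
      have h6 := norm_sub_le (h (x + r • a + r • b)) (h (x + r • a))
      have h7 := norm_sub_le (h (x + r • b)) (h x)
      linarith
    have hfin : ‖L (r • b) (r • a)‖ ≤ 4 * M + K * r * r := by
      have := norm_sub_le
        ((h (x + r • a + r • b) - h (x + r • a)) - (h (x + r • b) - h x))
        ((h (x + r • a + r • b) - h (x + r • a)) - (h (x + r • b) - h x) - L (r • b) (r • a))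
      rw [sub_sub_cancel] at this
      linarith
    rw [le_div_iff₀ (by positivity)]
    have hs : ‖L (r • b) (r • a)‖ = ‖L b a‖ * (r * r) := by
      simp only [map_smul, _root_.smul_apply, norm_smul,
        Real.norm_of_nonneg hr0.le]
      ring
    rwa [hs] at hfin
  have hsecond : ∀ y ∈ Metric.ball x R, ‖fderiv ℝ (fderiv ℝ h) y‖ ≤ B₂ := fun y hy => by
    have := norm_le_norm_add_norm_sub' (fderiv ℝ (fderiv ℝ h) y) (fderiv ℝ (fderiv ℝ h) x)
    linarith [hosc y hy]
  have hB₂0 : 0 ≤ B₂ := (norm_nonneg (fderiv ℝ (fderiv ℝ h) x)).trans (hsecond x hxb)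
  have hfirst0 : ‖fderiv ℝ h x‖ ≤ (2 * M + B₂ * r * r) / r := by
    refine ContinuousLinearMap.opNorm_le_of_unit_norm (by positivity) fun a ha => ?_
    have hsub : Metric.closedBall x r ⊆ Metric.ball x R :=
      Metric.closedBall_subset_ball (by rw [hr]; linarith)
    have hnorm : ‖x + r • a - x‖ = r := by simp [norm_smul, ha, abs_of_pos hr0]
    have hxa : x + r • a ∈ Metric.closedBall x r := by
      rw [mem_closedBall_iff_norm, hnorm]
    have hmv := (convex_closedBall x r).norm_image_sub_le_of_norm_fderiv_le'
      (f := h) (φ := fderiv ℝ h x) (C := B₂ * r) (fun y hy => hd1 y (hsub hy)) (fun y hy => by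
        refine (hconv.norm_image_sub_le_of_norm_fderiv_le hd2 hsecond hxb (hsub hy)).trans ?_
        exact mul_le_mul_of_nonneg_left (mem_closedBall_iff_norm.1 hy) hB₂0)
      (Metric.mem_closedBall_self hr0.le) hxa
    rw [hnorm, add_sub_cancel_left] at hmv
    have h1 := hM _ (hsub hxa)
    have h2 := hM _ hxb
    have h3 := norm_sub_le (h (x + r • a)) (h x)
    have h4 := norm_sub_le (h (x + r • a) - h x) (h (x + r • a) - h x - fderiv ℝ h x (r • a))
    rw [sub_sub_cancel] at h4
    have h5 : ‖fderiv ℝ h x (r • a)‖ = ‖fderiv ℝ h x a‖ * r := by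
      rw [map_smul, norm_smul, Real.norm_of_nonneg hr0.le, mul_comm]
    rw [le_div_iff₀ hr0]
    linarith
  have hfirst : ∀ y ∈ Metric.ball x R, ‖fderiv ℝ h y‖ ≤ B₁ := fun y hy => by
    have h1 := hconv.norm_image_sub_le_of_norm_fderiv_le hd2 hsecond hxb hy
    have h2 : B₂ * ‖y - x‖ ≤ B₂ * R :=
      mul_le_mul_of_nonneg_left (mem_ball_iff_norm.1 hy).le hB₂0
    have := norm_le_norm_add_norm_sub' (fderiv ℝ h y) (fderiv ℝ h x)
    linarith
  exact fun y hy => ⟨(hfirst y hy).trans (by simp), (hsecond y hy).trans (by simp)⟩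

theorem norm_fderiv_fderiv_eq (h : E → G) (x : E) :
    ‖fderiv ℝ (fderiv ℝ h) x‖ = ‖iteratedFDeriv ℝ 2 h x‖ := by
  rw [← norm_iteratedFDeriv_one, norm_iteratedFDeriv_fderiv]

/-- A `C²` function on an open set, composed with a graph map staying in a compact subset and
having bounded derivatives, has bounded derivatives up to order two. -/
theorem exists_bound_comp_graph {F : Type*} [NormedAddCommGroup F] [NormedSpace ℝ F]
    {H : E × F → G} {O Q : Set (E × F)} (hO : IsOpen O) (hH : ContDiffOn ℝ 2 H O)
    (hQ : IsCompact Q) (hQO : Q ⊆ O) {B : ℝ} (hB : 0 ≤ B) :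
    ∃ C : ℝ, ∀ (U : Set E) (ψ : E → F), IsOpen U → ContDiffOn ℝ 2 ψ U →
      (∀ y ∈ U, (y, ψ y) ∈ Q) →
      (∀ y ∈ U, ‖fderiv ℝ ψ y‖ ≤ B ∧ ‖fderiv ℝ (fderiv ℝ ψ) y‖ ≤ B) →
      ∀ y ∈ U, ‖H (y, ψ y)‖ ≤ C ∧ ‖fderiv ℝ (fun y => H (y, ψ y)) y‖ ≤ C ∧
        ‖fderiv ℝ (fderiv ℝ (fun y => H (y, ψ y))) y‖ ≤ C := by
  have hb : ∀ i : ℕ, i ≤ 2 → ∃ C, ∀ p ∈ Q, ‖iteratedFDerivWithin ℝ i H O p‖ ≤ C := fun i hi =>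
    hQ.exists_bound_of_continuousOn
      ((hH.continuousOn_iteratedFDerivWithin (by exact_mod_cast hi) hO.uniqueDiffOn).mono hQO)
  obtain ⟨C₀, h₀⟩ := hb 0 (by norm_num)
  obtain ⟨C₁, h₁⟩ := hb 1 (by norm_num)
  obtain ⟨C₂, h₂⟩ := hb 2 (by norm_num)
  set C := max C₀ (max C₁ C₂) with hC
  set D := 1 + B with hD
  refine ⟨max C (max (1 * C * D ^ 1) (2 * C * D ^ 2)), fun U ψ hU hψ hmaps hbd y hy => ?_⟩
  have hgraph : ContDiffOn ℝ 2 (fun y => (y, ψ y)) U := contDiffOn_id.prodMk hψ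
  have hCb : ∀ i ≤ 2, ‖iteratedFDerivWithin ℝ i H O (y, ψ y)‖ ≤ C := by
    intro i hi
    interval_cases i
    · exact (h₀ _ (hmaps y hy)).trans (le_max_left _ _)
    · exact (h₁ _ (hmaps y hy)).trans ((le_max_left _ _).trans (le_max_right _ _))
    · exact (h₂ _ (hmaps y hy)).trans ((le_max_right _ _).trans (le_max_right _ _))
  have hDb : ∀ i, 1 ≤ i → i ≤ 2 → ‖iteratedFDerivWithin ℝ i (fun y => (y, ψ y)) U y‖ ≤ D ^ i := by
    intro i hi1 hi2
    rw [iteratedFDerivWithin_of_isOpen i hU hy]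
    change ‖iteratedFDeriv ℝ i (fun y => (id y, ψ y)) y‖ ≤ D ^ i
    rw [iteratedFDeriv_prodMk (n := 2) contDiffAt_id
      (hψ.contDiffAt (hU.mem_nhds hy)) (by exact_mod_cast hi2),
      ContinuousMultilinearMap.opNorm_prod]
    interval_cases i
    · rw [norm_iteratedFDeriv_one, norm_iteratedFDeriv_one, fderiv_id, pow_one]
      exact max_le (ContinuousLinearMap.norm_id_le.trans (by linarith))
        ((hbd y hy).1.trans (by linarith))
    · rw [← norm_fderiv_fderiv_eq, ← norm_fderiv_fderiv_eq]
      have hid : fderiv ℝ (fderiv ℝ (id : E → E)) y = 0 := by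
        have : fderiv ℝ (id : E → E) = fun _ => ContinuousLinearMap.id ℝ E := by
          ext1 w; exact fderiv_id
        rw [this]; simp
      rw [hid, norm_zero]
      exact max_le (by positivity) ((hbd y hy).2.trans (by nlinarith))
  have hcomp : ∀ i : ℕ, i ≤ 2 →
      ‖iteratedFDeriv ℝ i (fun y => H (y, ψ y)) y‖ ≤ i.factorial * C * D ^ i := by
    intro i hi
    have := norm_iteratedFDerivWithin_comp_le hH hgraph (n := i) (by exact_mod_cast hi)
      hO.uniqueDiffOn hU.uniqueDiffOn (fun w hw => hQO (hmaps w hw)) hy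
      (fun j hj => hCb j (hj.trans hi)) (fun j hj1 hj2 => hDb j hj1 (hj2.trans hi))
    rwa [iteratedFDerivWithin_of_isOpen i hU hy] at this
  refine ⟨?_, ?_, ?_⟩
  · have := hCb 0 (by norm_num)
    rw [norm_iteratedFDerivWithin_zero] at this
    exact this.trans (le_max_left _ _)
  · have := hcomp 1 (by norm_num)
    rw [norm_iteratedFDeriv_one] at this
    refine this.trans (le_trans ?_ ((le_max_left _ _).trans (le_max_right _ _)))
    simp
  · have := hcomp 2 (by norm_num)
    rw [← norm_fderiv_fderiv_eq] at this
    refine this.trans (le_trans ?_ ((le_max_right _ _).trans (le_max_right _ _)))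
    simp

end DerivativeBounds

section PointwiseFormula

variable {E : Type*} [NormedAddCommGroup E] [NormedSpace ℝ E] {f : E → ℝ} {S : Set E}

/-- The Hessian of a convex `C²` function is positive semidefinite. -/
theorem ConvexOn.fderiv_fderiv_nonneg (hS : IsOpen S) (hf : ContDiffOn ℝ 2 f S)
    (hc : ConvexOn ℝ S f) {p : E} (hp : p ∈ S) (w : E) :
    0 ≤ fderiv ℝ (fderiv ℝ f) p w w := by
  set ℓ : ℝ →ᵃ[ℝ] E := AffineMap.lineMap p (p + w) with hℓ
  have hℓs : ∀ s, ℓ s = p + s • w := fun s => by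
    simp [hℓ, AffineMap.lineMap_apply, add_comm]
  have hℓd : ∀ s, HasDerivAt ℓ w s := fun s => by
    have : (ℓ : ℝ → E) = fun s => p + s • w := funext hℓs
    rw [this]
    simpa using ((hasDerivAt_id s).smul_const w).const_add p
  have hℓ0 : ℓ 0 = p := by simp [hℓs]
  set I : Set ℝ := ℓ ⁻¹' S
  have hI : IsOpen I := hS.preimage
    (continuous_iff_continuousAt.2 fun s => (hℓd s).continuousAt)
  have h0 : (0 : ℝ) ∈ I := by simpa [I, hℓ0] using hp
  have hderiv : ∀ s ∈ I, HasDerivAt (f ∘ ℓ) (fderiv ℝ f (ℓ s) w) s := fun s hs =>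
    ((hf.differentiableOn (by norm_num) _ hs).differentiableAt
      (hS.mem_nhds hs)).hasFDerivAt.comp_hasDerivAt s (hℓd s)
  have hmono : MonotoneOn (deriv (f ∘ ℓ)) I :=
    (hc.comp_affineMap ℓ).monotoneOn_deriv fun s hs => (hderiv s hs).differentiableAt
  have hmono' : MonotoneOn (fun s => fderiv ℝ f (ℓ s) w) I :=
    hmono.congr fun s hs => (hderiv s hs).deriv
  have hd2 : DifferentiableAt ℝ (fderiv ℝ f) (ℓ 0) :=
    ((hf.fderiv_of_isOpen (m := 1) hS (by norm_num)).differentiableOn (by norm_num) _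
      h0).differentiableAt (hS.mem_nhds h0)
  have h2 : HasDerivAt (fun s => fderiv ℝ f (ℓ s) w) (fderiv ℝ (fderiv ℝ f) p w w) 0 := by
    have := (hd2.hasFDerivAt.comp_hasDerivAt (0 : ℝ) (hℓd 0)).clm_apply (hasDerivAt_const 0 w)
    simpa [hℓ0] using this
  have h3 := hmono'.derivWithin_nonneg (x := 0)
  rwa [derivWithin_of_isOpen hI h0, h2.deriv] at h3

/-- A null direction of the Hessian of a convex function lies in its kernel. -/
theorem ConvexOn.fderiv_fderiv_eq_zero (hS : IsOpen S) (hf : ContDiffOn ℝ 2 f S)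
    (hc : ConvexOn ℝ S f) {p : E} (hp : p ∈ S) {v : E}
    (hv : fderiv ℝ (fderiv ℝ f) p v v = 0) (u : E) :
    fderiv ℝ (fderiv ℝ f) p v u = 0 := by
  set A := fderiv ℝ (fderiv ℝ f) p with hA
  have hsymm : A u v = A v u :=
    (hf.contDiffAt (hS.mem_nhds hp)).isSymmSndFDerivAt (by simp) u v
  have hu : 0 ≤ A u u := hc.fderiv_fderiv_nonneg hS hf hp u
  have key : ∀ s : ℝ, 0 ≤ 2 * s * A v u + s ^ 2 * A u u := by
    intro s
    have := hc.fderiv_fderiv_nonneg hS hf hp (v + s • u)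
    rw [← hA] at this
    simp only [map_add, map_smul, _root_.add_apply, _root_.smul_apply, smul_eq_mul, hv,
      hsymm] at this
    linarith
  by_contra hne
  have hpos : 0 < (A v u) ^ 2 := by positivity
  have h1 : 0 < 1 + A u u := by linarith
  have := key (-(A v u) / (1 + A u u))
  have h2 : 2 * (-(A v u) / (1 + A u u)) * A v u + (-(A v u) / (1 + A u u)) ^ 2 * A u u
      = -((A v u) ^ 2 * (2 + A u u)) / (1 + A u u) ^ 2 := by
    field_simp
    ring
  rw [h2, neg_div, Left.nonneg_neg_iff] at this
  have : 0 < (A v u) ^ 2 * (2 + A u u) / (1 + A u u) ^ 2 := by positivity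
  linarith

/-- If the Hessian of a convex `C³` function degenerates in the direction `v`, so does the
derivative of the Hessian. -/
theorem ConvexOn.fderiv_fderiv_fderiv_eq_zero (hS : IsOpen S) (hf : ContDiffOn ℝ 3 f S)
    (hc : ConvexOn ℝ S f) {p : E} (hp : p ∈ S) {v : E}
    (hv : fderiv ℝ (fderiv ℝ f) p v v = 0) (u : E) :
    fderiv ℝ (fderiv ℝ (fderiv ℝ f)) p v v u = 0 := by
  have hf1 : ContDiffOn ℝ 2 (fderiv ℝ f) S := hf.fderiv_of_isOpen hS (by norm_num)
  have hf2 : ContDiffOn ℝ 1 (fderiv ℝ (fderiv ℝ f)) S := hf1.fderiv_of_isOpen hS (by norm_num)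
  have hd : HasFDerivAt (fderiv ℝ (fderiv ℝ f)) (fderiv ℝ (fderiv ℝ (fderiv ℝ f)) p) p :=
    ((hf2.differentiableOn (by norm_num) p hp).differentiableAt (hS.mem_nhds hp)).hasFDerivAt
  have happ : ∀ a b : E, HasFDerivAt (fun y => fderiv ℝ (fderiv ℝ f) y a b)
      (((fderiv ℝ (fderiv ℝ (fderiv ℝ f)) p).flip a).flip b) p := fun a b => by
    simpa using (hd.clm_apply (hasFDerivAt_const a p)).clm_apply (hasFDerivAt_const b p)
  have hfle : ContDiffOn ℝ 2 f S := hf.of_le (by norm_num)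
  have hmin : IsLocalMin (fun y => fderiv ℝ (fderiv ℝ f) y v v) p := by
    filter_upwards [hS.mem_nhds hp] with y hy
    rw [hv]
    exact hc.fderiv_fderiv_nonneg hS hfle hy v
  have hzero : fderiv ℝ (fderiv ℝ (fderiv ℝ f)) p u v v = 0 := by
    have := hmin.fderiv_eq_zero
    rw [(happ v v).fderiv] at this
    simpa using congrArg (fun L : E →L[ℝ] ℝ => L u) this
  have hswap : fderiv ℝ (fderiv ℝ (fderiv ℝ f)) p v v u
      = fderiv ℝ (fderiv ℝ (fderiv ℝ f)) p v u v := by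
    have hev : (fun y => fderiv ℝ (fderiv ℝ f) y v u) =ᶠ[nhds p]
        fun y => fderiv ℝ (fderiv ℝ f) y u v := by
      filter_upwards [hS.mem_nhds hp] with y hy
      exact (hfle.contDiffAt (hS.mem_nhds hy)).isSymmSndFDerivAt (by simp) v u
    have := hev.fderiv_eq (𝕜 := ℝ)
    rw [(happ v u).fderiv, (happ u v).fderiv] at this
    simpa using congrArg (fun L : E →L[ℝ] ℝ => L v) this
  have hsymm : fderiv ℝ (fderiv ℝ (fderiv ℝ f)) p v u
      = fderiv ℝ (fderiv ℝ (fderiv ℝ f)) p u v :=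
    (hf1.contDiffAt (hS.mem_nhds hp)).isSymmSndFDerivAt (by simp) v u
  rw [hswap, hsymm, hzero]

theorem dmix_eq_fderiv_fderiv {n : ℕ} {F : Type*} [NormedAddCommGroup F] [NormedSpace ℝ F]
    {f : (Fin n → ℝ) → F} {x : Fin n → ℝ} (hf : DifferentiableAt ℝ (fderiv ℝ f) x)
    (v w : Fin n → ℝ) : dmix f x v w = fderiv ℝ (fderiv ℝ f) x w v := by
  have := hf.hasFDerivAt.clm_apply (hasFDerivAt_const v x)
  unfold dmix
  rw [this.fderiv]
  simp

theorem dir2_const_mul {n : ℕ} (c : ℝ) (g : (Fin n → ℝ) → ℝ) (x v : Fin n → ℝ) :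
    dir2 (fun y => c * g y) x v = c * dir2 g x v := by
  have h : ∀ (u : (Fin n → ℝ) → ℝ) (y : Fin n → ℝ),
      fderiv ℝ (fun y => c * u y) y v = c * fderiv ℝ u y v := fun u y => by
    change fderiv ℝ (c • u) y v = _
    rw [fderiv_const_smul_field]
    rfl
  unfold dir2 dmix
  simp only [h]

/-- The second directional derivative of the jump integrand in a null direction of the Hessian. -/
theorem dir2_jump_integrand {n : ℕ} {f : (Fin n → ℝ) → ℝ} {S U : Set (Fin n → ℝ)}
    (hS : IsOpen S) (hf : ContDiffOn ℝ 3 f S) (hc : ConvexOn ℝ S f) (hU : IsOpen U) (hUS : U ⊆ S)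
    {φ : (Fin n → ℝ) → (Fin n → ℝ)} (hφ : ContDiffOn ℝ 2 φ U) (hmaps : ∀ y ∈ U, y + φ y ∈ S)
    {x : Fin n → ℝ} (hx : x ∈ U) {v : Fin n → ℝ} (hv : fderiv ℝ (fderiv ℝ f) x v v = 0) :
    dir2 (fun y => f (y + φ y) - f y - fderiv ℝ f y (φ y)) x v
      = fderiv ℝ (fderiv ℝ f) (x + φ x) (v + fderiv ℝ φ x v) (v + fderiv ℝ φ x v)
        + (fderiv ℝ f (x + φ x) (dir2 φ x v) - fderiv ℝ f x (dir2 φ x v)) := by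
  have hf1 : ContDiffOn ℝ 2 (fderiv ℝ f) S := hf.fderiv_of_isOpen hS (by norm_num)
  have hf2 : ContDiffOn ℝ 1 (fderiv ℝ (fderiv ℝ f)) S := hf1.fderiv_of_isOpen hS (by norm_num)
  have hφ1 : ContDiffOn ℝ 1 (fderiv ℝ φ) U := hφ.fderiv_of_isOpen hU (by norm_num)
  have d0 : ∀ p ∈ S, HasFDerivAt f (fderiv ℝ f p) p := fun p hp =>
    ((hf.differentiableOn (by norm_num) p hp).differentiableAt (hS.mem_nhds hp)).hasFDerivAt
  have d1 : ∀ p ∈ S, HasFDerivAt (fderiv ℝ f) (fderiv ℝ (fderiv ℝ f) p) p := fun p hp =>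
    ((hf1.differentiableOn (by norm_num) p hp).differentiableAt (hS.mem_nhds hp)).hasFDerivAt
  have d2 : ∀ p ∈ S, HasFDerivAt (fderiv ℝ (fderiv ℝ f))
      (fderiv ℝ (fderiv ℝ (fderiv ℝ f)) p) p := fun p hp =>
    ((hf2.differentiableOn (by norm_num) p hp).differentiableAt (hS.mem_nhds hp)).hasFDerivAt
  have e0 : ∀ y ∈ U, HasFDerivAt φ (fderiv ℝ φ y) y := fun y hy =>
    ((hφ.differentiableOn (by norm_num) y hy).differentiableAt (hU.mem_nhds hy)).hasFDerivAt
  have e1 : HasFDerivAt (fderiv ℝ φ) (fderiv ℝ (fderiv ℝ φ) x) x :=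
    ((hφ1.differentiableOn (by norm_num) x hx).differentiableAt (hU.mem_nhds hx)).hasFDerivAt
  have hψ : ∀ y ∈ U, HasFDerivAt (fun y => y + φ y)
      (ContinuousLinearMap.id ℝ (Fin n → ℝ) + fderiv ℝ φ y) y := fun y hy =>
    (hasFDerivAt_id y).add (e0 y hy)
  have hev : (fun y => fderiv ℝ (fun y => f (y + φ y) - f y - fderiv ℝ f y (φ y)) y v)
      =ᶠ[nhds x] fun y => fderiv ℝ f (y + φ y) (v + fderiv ℝ φ y v) - fderiv ℝ f y v
        - (fderiv ℝ (fderiv ℝ f) y v (φ y) + fderiv ℝ f y (fderiv ℝ φ y v)) := by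
    filter_upwards [hU.mem_nhds hx] with y hy
    have h := (((d0 _ (hmaps y hy)).comp y (hψ y hy)).sub (d0 y (hUS hy))).sub
      ((d1 y (hUS hy)).clm_apply (e0 y hy))
    have h' : fderiv ℝ (fun y => f (y + φ y) - f y - fderiv ℝ f y (φ y)) y = _ := h.fderiv
    rw [h']
    simp [add_comm]
  have q1 : HasFDerivAt (fun y => fderiv ℝ φ y v) ((fderiv ℝ (fderiv ℝ φ) x).flip v) x := by
    simpa using e1.clm_apply (hasFDerivAt_const v x)
  have q2 : HasFDerivAt (fun y => fderiv ℝ f y v) ((fderiv ℝ (fderiv ℝ f) x).flip v) x := by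
    simpa using (d1 x (hUS hx)).clm_apply (hasFDerivAt_const v x)
  have q3 : HasFDerivAt (fun y => fderiv ℝ (fderiv ℝ f) y v)
      ((fderiv ℝ (fderiv ℝ (fderiv ℝ f)) x).flip v) x := by
    simpa using (d2 x (hUS hx)).clm_apply (hasFDerivAt_const v x)
  have q4 : HasFDerivAt (fun y => fderiv ℝ f (y + φ y))
      ((fderiv ℝ (fderiv ℝ f) (x + φ x)).comp
        (ContinuousLinearMap.id ℝ (Fin n → ℝ) + fderiv ℝ φ x)) x :=
    (d1 _ (hmaps x hx)).comp x (hψ x hx)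
  have h := ((q4.clm_apply (q1.const_add v)).sub q2).sub
    ((q3.clm_apply (e0 x hx)).add ((d1 x (hUS hx)).clm_apply q1))
  have hφvv : dir2 φ x v = fderiv ℝ (fderiv ℝ φ) x v v :=
    dmix_eq_fderiv_fderiv e1.differentiableAt v v
  have hfle : ContDiffOn ℝ 2 f S := hf.of_le (by norm_num)
  have z1 := hc.fderiv_fderiv_eq_zero hS hfle (hUS hx) hv (fderiv ℝ φ x v)
  have z2 := hc.fderiv_fderiv_fderiv_eq_zero hS hf (hUS hx) hv (φ x)
  rw [hφvv]
  conv_lhs => unfold dir2 dmix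
  rw [hev.fderiv_eq]
  have h' : fderiv ℝ (fun y => fderiv ℝ f (y + φ y) (v + fderiv ℝ φ y v) - fderiv ℝ f y v
      - (fderiv ℝ (fderiv ℝ f) y v (φ y) + fderiv ℝ f y (fderiv ℝ φ y v))) x = _ := h.fderiv
  rw [h']
  simp [z1, z2, hv]
  ring

end PointwiseFormula

section Orthant

variable {n : ℕ}

theorem isOpen_posOrth : IsOpen (posOrth n) := by
  simp only [posOrth, Set.ofPred_forall]
  exact isOpen_iInter_of_finite fun i => isOpen_lt continuous_const (continuous_apply i)

/-- Composing a function continuous on the open orthant with a measurable map into the orthant. -/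
theorem aestronglyMeasurable_comp_of_mem_posOrth {Z : Type*} [MeasurableSpace Z] {μ : Measure Z}
    {f : (Fin n → ℝ) → ℝ} (hf : ContinuousOn f (posOrth n)) {ψ : Z → Fin n → ℝ}
    (hψ : Measurable ψ) (hmem : ∀ᵐ z ∂μ, ψ z ∈ posOrth n) :
    AEStronglyMeasurable (fun z => f (ψ z)) μ := by
  classical
  have h : Measurable ((posOrth n).piecewise f 0) :=
    hf.measurable_piecewise continuousOn_const isOpen_posOrth.measurableSet
  refine (h.comp hψ).aestronglyMeasurable.congr ?_
  filter_upwards [hmem] with z hz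
  exact Set.piecewise_eq_of_mem _ _ _ hz

/-- Near any point of the orthant the jump kernel takes, together with its target, values in a
fixed compact set, and has derivatives up to order two bounded uniformly in `z`. -/
theorem JumpKernel.exists_uniform_nhds {T : ℝ} (K : JumpKernel n T) {x : Fin n → ℝ}
    (hx : x ∈ posOrth n) {t : ℝ} (ht : t ∈ Icc (0 : ℝ) T) :
    ∃ (U : Set (Fin n → ℝ)) (Q : Set ((Fin n → ℝ) × (Fin n → ℝ))) (B : ℝ),
      IsOpen U ∧ x ∈ U ∧ U ⊆ posOrth n ∧ IsCompact Q ∧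
      (∀ p ∈ Q, p.1 ∈ posOrth n ∧ p.1 + p.2 ∈ posOrth n) ∧ 0 ≤ B ∧
      ∀ z ∈ Icc (0 : ℝ) 1, ∀ y ∈ U, (y, K.φ y t z) ∈ Q ∧
        ‖fderiv ℝ (fun y => K.φ y t z) y‖ ≤ B ∧
        ‖fderiv ℝ (fderiv ℝ (fun y => K.φ y t z)) y‖ ≤ B := by
  obtain ⟨α, -, -, hH⟩ := K.holder2
  obtain ⟨s, hs, hsS, C, hC⟩ := hH t ht x hx
  obtain ⟨D, hD, hbd⟩ := K.bound
  obtain ⟨γ, hγ, hlow⟩ := K.lower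
  have hbox : {y : Fin n → ℝ | ∀ i, x i / 2 < y i ∧ y i < 2 * x i} ∈ nhds x := by
    refine IsOpen.mem_nhds ?_ fun i => ⟨by linarith [hx i], by linarith [hx i]⟩
    simp only [Set.ofPred_forall]
    exact isOpen_iInter_of_finite fun i =>
      (isOpen_lt continuous_const (continuous_apply i)).inter
        (isOpen_lt (continuous_apply i) continuous_const)
  obtain ⟨R, hR, hRs⟩ := Metric.mem_nhds_iff.1 (Filter.inter_mem hs hbox)
  have habs : ∀ z ∈ Icc (0 : ℝ) 1, ∀ y ∈ Metric.ball x R, ∀ i,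
      |K.φ y t z i| ≤ Real.sqrt D * (2 * x i) := by
    intro z hz y hy i
    have hy0 := hsS (hRs hy).1 i
    have h1 : |K.φ y t z i| ≤ Real.sqrt D * y i := by
      rw [← Real.sqrt_sq hy0.le, ← Real.sqrt_mul hD.le]
      exact Real.abs_le_sqrt (hbd y (hsS (hRs hy).1) t ht z hz i)
    exact h1.trans (mul_le_mul_of_nonneg_left ((hRs hy).2 i).2.le (Real.sqrt_nonneg D))
  obtain ⟨B, hB, hder⟩ := exists_bound_fderiv_of_bound_of_osc (E := Fin n → ℝ) (G := Fin n → ℝ)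
    hR (Real.sqrt D * (2 * ‖x‖)) (C * R ^ (α : ℝ))
  refine ⟨Metric.ball x R,
    (fun p : (Fin n → ℝ) × (Fin n → ℝ) => (p.1, p.2 - p.1)) ''
      (Icc (fun i => x i / 2) (fun i => 2 * x i) ×ˢ
        Icc (fun i => (1 + γ) * (x i / 2)) (fun i => 2 * x i + Real.sqrt D * (2 * x i))), B,
    Metric.isOpen_ball, Metric.mem_ball_self hR, fun y hy => hsS (hRs hy).1,
    (isCompact_Icc.prod isCompact_Icc).image (by fun_prop), ?_, hB, ?_⟩
  · rintro _ ⟨p, ⟨hp1, hp2⟩, rfl⟩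
    refine ⟨fun i => lt_of_lt_of_le (by linarith [hx i]) (hp1.1 i), fun i => ?_⟩
    have h := hp2.1 i
    have h0 : 0 < (1 + γ) * (x i / 2) := mul_pos (by linarith) (by linarith [hx i])
    simpa using h0.trans_le h
  · intro z hz y hy
    refine ⟨⟨(y, y + K.φ y t z), ⟨⟨fun i => ((hRs hy).2 i).1.le, fun i => ((hRs hy).2 i).2.le⟩,
      fun i => ?_, fun i => ?_⟩, by simp⟩, ?_⟩
    · have h1 := hlow y (hsS (hRs hy).1) t ht z hz i
      have h2 : (1 + γ) * (x i / 2) ≤ (1 + γ) * y i :=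
        mul_le_mul_of_nonneg_left ((hRs hy).2 i).1.le (by linarith)
      simp only [Pi.add_apply]
      linarith
    · have h1 := (abs_le.1 (habs z hz y hy i)).2
      have h2 := ((hRs hy).2 i).2
      simp only [Pi.add_apply]
      linarith
    · refine hder (fun y => K.φ y t z) x ((K.smooth t ht z hz).mono fun y hy => hsS (hRs hy).1)
        (fun w hw => ?_) (fun w hw => ?_) y hy
      · refine (pi_norm_le_iff_of_nonneg (by positivity)).2 fun i => ?_
        refine (habs z hz w hw i).trans ?_
        have := (le_abs_self (x i)).trans (norm_le_pi_norm x i)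
        gcongr
      · rw [← dist_eq_norm]
        refine ((hC z hz).dist_le (hRs hw).1 (mem_of_mem_nhds hs)).trans ?_
        have := (Metric.mem_ball.1 hw).le
        gcongr

end Orthant

/-- Corollary 5.2: if condition (cond) holds at `(x,t)`, i.e.
`∫₀¹ φ_vv·(∇f(x+φ) − ∇f(x)) dz ≥ 0` for all convex `f ∈ F` and all directions `v ≠ 0`,
then the operator `B` is LCP at `(x,t)`. -/
theorem isLCPAt_Bop_of_cond {n : ℕ} {T : ℝ} (hT : 0 < T)
    (K : JumpKernel n T) (hK : K.AENonzero)
    (lam : ℝ → ℝ) (hlam : LamOK T lam)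
    (x : Fin n → ℝ) (hx : x ∈ posOrth n)
    (t : ℝ) (ht : t ∈ Set.Icc (0:ℝ) T)
    (hcond : ∀ f : (Fin n → ℝ) → ℝ, MemTestClass n f → ConvexOn ℝ (posOrth n) f →
      ∀ v : Fin n → ℝ, v ≠ 0 →
        0 ≤ ∫ z in Icc (0:ℝ) 1,
          (fderiv ℝ f (x + K.φ x t z) (dir2 (fun y => K.φ y t z) x v)
            - fderiv ℝ f x (dir2 (fun y => K.φ y t z) x v))) :
    IsLCPAt (Bop lam K) x t := by
  intro v hv f hf hconv hvv
  set S := posOrth n with hS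
  have hSo : IsOpen S := isOpen_posOrth
  have hf3 : ContDiffOn ℝ 3 f S := hf.smooth.of_le (by norm_num)
  have hf1 : ContDiffOn ℝ 2 (fderiv ℝ f) S := hf3.fderiv_of_isOpen hSo (by norm_num)
  obtain ⟨U, Q, B, hU, hxU, hUS, hQ, hQS, hB, hbd⟩ := K.exists_uniform_nhds hx ht
  set μ : Measure ℝ := volume.restrict (Icc (0 : ℝ) 1) with hμ
  have hz01 : ∀ᵐ z ∂μ, z ∈ Icc (0 : ℝ) 1 := ae_restrict_mem measurableSet_Icc
  have hmem : ∀ z ∈ Icc (0 : ℝ) 1, ∀ y ∈ U, y + K.φ y t z ∈ S := fun z hz y hy =>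
    (hQS _ (hbd z hz y hy).1).2
  have hφ : ∀ z ∈ Icc (0 : ℝ) 1, ContDiffOn ℝ 2 (fun y => K.φ y t z) U := fun z hz =>
    (K.smooth t ht z hz).mono hUS
  have hφm : ∀ y ∈ U, Measurable (fun z => K.φ y t z) := fun y hy => K.meas y (hUS hy) t ht
  -- The jump integrand is a `C²` function `H` of the pair `(y, φ y)`.
  set H : (Fin n → ℝ) × (Fin n → ℝ) → ℝ := fun p => f (p.1 + p.2) - f p.1 - fderiv ℝ f p.1 p.2
    with hHdef
  set O : Set ((Fin n → ℝ) × (Fin n → ℝ)) := {p | p.1 ∈ S ∧ p.1 + p.2 ∈ S} with hO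
  have hOo : IsOpen O := (hSo.preimage continuous_fst).inter
    (hSo.preimage (continuous_fst.add continuous_snd))
  have hHO : ContDiffOn ℝ 2 H O := by
    have hf2 : ContDiffOn ℝ 2 f S := hf3.of_le (by norm_num)
    exact ((hf2.comp (contDiff_fst.add contDiff_snd).contDiffOn fun p hp => hp.2).sub
      (hf2.comp contDiff_fst.contDiffOn fun p hp => hp.1)).sub
      ((hf1.comp contDiff_fst.contDiffOn fun p hp => hp.1).clm_apply contDiff_snd.contDiffOn)
  obtain ⟨C, hC⟩ := exists_bound_comp_graph hOo hHO hQ (fun p hp => hQS p hp) hB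
  have hC' := fun z (hz : z ∈ Icc (0 : ℝ) 1) => hC U (fun y => K.φ y t z) hU (hφ z hz)
    (fun y hy => (hbd z hz y hy).1) (fun y hy => (hbd z hz y hy).2)
  have hmeas : ∀ y ∈ U, AEStronglyMeasurable (fun z => H (y, K.φ y t z)) μ := by
    intro y hy
    have h : AEStronglyMeasurable (fun z => f (y + K.φ y t z)) μ := by
      refine aestronglyMeasurable_comp_of_mem_posOrth hf3.continuousOn
        (measurable_const.add (hφm y hy)) ?_
      filter_upwards [hz01] with z hz using hmem z hz y hy
    exact (h.sub (aestronglyMeasurable_const (b := f y))).sub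
      ((fderiv ℝ f y).continuous.measurable.comp (hφm y hy)).aestronglyMeasurable
  have hdir : dir2 (fun y => ∫ z, H (y, K.φ y t z) ∂μ) x v
      = ∫ z, dir2 (fun y => H (y, K.φ y t z)) x v ∂μ := by
    refine dir2_integral_of_bounded hU (C := C) hmeas ?_ ?_ ?_ ?_ hxU v
    · filter_upwards [hz01] with z hz
      exact hHO.comp (contDiffOn_id.prodMk (hφ z hz)) fun y hy => hQS _ (hbd z hz y hy).1
    · filter_upwards [hz01] with z hz y hy using (hC' z hz y hy).1
    · filter_upwards [hz01] with z hz y hy using (hC' z hz y hy).2.1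
    · filter_upwards [hz01] with z hz y hy using (hC' z hz y hy).2.2
  have hφ2 : ∀ z ∈ Icc (0 : ℝ) 1, ∀ y ∈ U,
      DifferentiableAt ℝ (fderiv ℝ (fun y => K.φ y t z)) y := fun z hz y hy =>
    (((hφ z hz).fderiv_of_isOpen (m := 1) hU (by norm_num)).differentiableOn (by norm_num)
      y hy).differentiableAt (hU.mem_nhds hy)
  have hvv' : fderiv ℝ (fderiv ℝ f) x v v = 0 := by
    rw [← hvv]
    exact (dmix_eq_fderiv_fderiv ((hf1.differentiableOn (by norm_num) x hx).differentiableAt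
      (hSo.mem_nhds hx)) v v).symm
  set c : ℝ → ℝ := fun z => fderiv ℝ f (x + K.φ x t z) (dir2 (fun y => K.φ y t z) x v)
    - fderiv ℝ f x (dir2 (fun y => K.φ y t z) x v) with hc
  have hle : ∀ z ∈ Icc (0 : ℝ) 1, c z ≤ dir2 (fun y => H (y, K.φ y t z)) x v := by
    intro z hz
    have h1 := dir2_jump_integrand hSo hf3 hconv hU hUS (hφ z hz) (hmem z hz) hxU hvv'
    have h2 := hconv.fderiv_fderiv_nonneg hSo (hf3.of_le (by norm_num)) (hmem z hz x hxU)
      (v + fderiv ℝ (fun y => K.φ y t z) x v)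
    change c z ≤ dir2 (fun y => f (y + K.φ y t z) - f y - fderiv ℝ f y (K.φ y t z)) x v
    rw [h1]
    simp only [hc]
    linarith
  have hφvvm : AEStronglyMeasurable (fun z => dir2 (fun y => K.φ y t z) x v) μ := by
    refine aestronglyMeasurable_fderiv_apply_param hU
      (g := fun y z => fderiv ℝ (fun y => K.φ y t z) y v) (fun y hy => ?_) ?_ hxU v
    · refine aestronglyMeasurable_fderiv_apply_param hU
        (fun y hy => (hφm y hy).aestronglyMeasurable) ?_ hy v
      filter_upwards [hz01] with z hz using (hφ z hz).differentiableOn (by norm_num)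
    · filter_upwards [hz01] with z hz y hy
      exact ((hφ2 z hz y hy).clm_apply (differentiableAt_const v)).differentiableWithinAt
  have hcm : AEStronglyMeasurable c μ := by
    have h1 : AEStronglyMeasurable (fun z => fderiv ℝ f (x + K.φ x t z)) μ :=
      ((measurable_fderiv ℝ f).comp
        (measurable_const.add (hφm x hxU))).stronglyMeasurable.aestronglyMeasurable
    exact (isBoundedBilinearMap_apply.continuous.comp_aestronglyMeasurable
      (h1.prodMk hφvvm)).sub ((fderiv ℝ f x).continuous.comp_aestronglyMeasurable hφvvm)
  have hci : Integrable c μ := by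
    obtain ⟨M, hM⟩ := hQ.exists_bound_of_continuousOn
      (f := fun p => fderiv ℝ f (p.1 + p.2) - fderiv ℝ f p.1)
      ((hf1.continuousOn.comp (continuous_fst.add continuous_snd).continuousOn
        fun p hp => (hQS p hp).2).sub
        (hf1.continuousOn.comp continuous_fst.continuousOn fun p hp => (hQS p hp).1))
    refine Integrable.of_bound hcm (M * (B * ‖v‖ * ‖v‖)) ?_
    filter_upwards [hz01] with z hz
    have h1 := hM _ (hbd z hz x hxU).1
    have h2 : ‖dir2 (fun y => K.φ y t z) x v‖ ≤ B * ‖v‖ * ‖v‖ := by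
      rw [dir2, dmix_eq_fderiv_fderiv (hφ2 z hz x hxU)]
      exact ContinuousLinearMap.le_of_opNorm_le _
        (ContinuousLinearMap.le_of_opNorm_le _ (hbd z hz x hxU).2.2 v) v
    have h3 : c z = (fderiv ℝ f (x + K.φ x t z) - fderiv ℝ f x)
      (dir2 (fun y => K.φ y t z) x v) := rfl
    rw [h3]
    exact (ContinuousLinearMap.le_of_opNorm_le _ h1 _).trans
      (mul_le_mul_of_nonneg_left h2 ((norm_nonneg _).trans h1))
  have hgi : 0 ≤ ∫ z, dir2 (fun y => H (y, K.φ y t z)) x v ∂μ := by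
    by_cases hi : Integrable (fun z => dir2 (fun y => H (y, K.φ y t z)) x v) μ
    · refine (hcond f hf hconv v hv).trans (integral_mono_ae hci hi ?_)
      filter_upwards [hz01] with z hz using hle z hz
    · rw [integral_undef hi]
  have hBop : dir2 (fun y => Bop lam K f y t) x v
      = lam t * dir2 (fun y => ∫ z, H (y, K.φ y t z) ∂μ) x v :=
    dir2_const_mul _ _ _ _
  rw [hBop, hdir]
  exact mul_nonneg (hlam.1 t ht) hgi

end
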